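/- Let n ≥ 1 and let (T_t)_{t>0} be the classical heat semigroup on ℝⁿ, T_t f = K_t * f with Gaussian kernel K_t(x) = (4πt)^{-n/2} exp(−|x|²/(4t)). Then there is a constant c_n > 0, depending only on n, such that for all t > 0 and all nonnegative f, g ∈ L¹(ℝⁿ), ∫_{ℝⁿ} (T_t(f · T_t g)(x))^{1/2} dx ≤ c_n (∫_{ℝⁿ} f)^{1/2} (∫_{ℝⁿ} g)^{1/2}; that is, the heat semigroup satisfies the L^{1/2} condition ‖T_t(f T_t g)‖_{L^{1/2}} ≤ c_n² ‖f‖_{L¹} ‖g‖_{L¹}. -/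

import Mathlib

open MeasureTheory Set
open scoped ENNReal

noncomputable section

/-- The classical heat semigroup on `ℝⁿ`: `T_t f = K_t * f` with the Gaussian kernel
`K_t(x) = (4πt)^{-n/2} exp(-|x|²/(4t))`. -/
def heatOp (n : ℕ) (t : ℝ) (f : EuclideanSpace ℝ (Fin n) → ℝ)
    (x : EuclideanSpace ℝ (Fin n)) : ℝ :=
  ∫ z, (4 * Real.pi * t) ^ (-(n : ℝ) / 2) * Real.exp (-‖x - z‖ ^ 2 / (4 * t)) * f z

/-- The Gaussian heat kernel on `ℝⁿ` at time `t`. -/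
def heatKernel (n : ℕ) (t : ℝ) (x : EuclideanSpace ℝ (Fin n)) : ℝ :=
  (4 * Real.pi * t) ^ (-(n : ℝ) / 2) * Real.exp (-‖x‖ ^ 2 / (4 * t))

lemma heatOp_eq_integral (n : ℕ) (t : ℝ) (f : EuclideanSpace ℝ (Fin n) → ℝ)
    (x : EuclideanSpace ℝ (Fin n)) :
    heatOp n t f x = ∫ z, heatKernel n t (x - z) * f z := rfl

lemma heatKernel_nonneg (n : ℕ) {t : ℝ} (ht : 0 < t) (x : EuclideanSpace ℝ (Fin n)) :
    0 ≤ heatKernel n t x := by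
  unfold heatKernel
  positivity

lemma continuous_heatKernel (n : ℕ) (t : ℝ) : Continuous (heatKernel n t) := by
  unfold heatKernel
  fun_prop

lemma heatKernel_le (n : ℕ) {t : ℝ} (ht : 0 < t) (x : EuclideanSpace ℝ (Fin n)) :
    heatKernel n t x ≤ (4 * Real.pi * t) ^ (-(n : ℝ) / 2) := by
  unfold heatKernel
  refine mul_le_of_le_one_right (by positivity) (Real.exp_le_one_iff.2 ?_)
  rw [neg_div, neg_nonpos]
  positivity

lemma integral_heatKernel (n : ℕ) {t : ℝ} (ht : 0 < t) : ∫ x, heatKernel n t x = 1 := by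
  unfold heatKernel
  have h (x : EuclideanSpace ℝ (Fin n)) : -‖x‖ ^ 2 / (4 * t) = -(1 / (4 * t)) * ‖x‖ ^ 2 := by
    ring
  simp_rw [h]
  rw [integral_const_mul, GaussianFourier.integral_rexp_neg_mul_sq_norm (by positivity),
    finrank_euclideanSpace_fin, show Real.pi / (1 / (4 * t)) = 4 * Real.pi * t by field_simp,
    ← Real.rpow_add (by positivity), neg_div, neg_add_cancel, Real.rpow_zero]

lemma integrable_heatKernel (n : ℕ) {t : ℝ} (ht : 0 < t) : Integrable (heatKernel n t) :=
  .of_integral_ne_zero (by rw [integral_heatKernel n ht]; exact one_ne_zero)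

lemma integrable_heatKernel_sub_mul (n : ℕ) {t : ℝ} (ht : 0 < t)
    {f : EuclideanSpace ℝ (Fin n) → ℝ} (hf : Integrable f) (x : EuclideanSpace ℝ (Fin n)) :
    Integrable fun z => heatKernel n t (x - z) * f z := by
  refine hf.bdd_mul (c := (4 * Real.pi * t) ^ (-(n : ℝ) / 2))
    ((continuous_heatKernel n t).comp (continuous_const.sub continuous_id)).aestronglyMeasurable
    (.of_forall fun z => ?_)
  rw [Real.norm_of_nonneg (heatKernel_nonneg n ht _)]
  exact heatKernel_le n ht _

lemma heatOp_nonneg (n : ℕ) {t : ℝ} (ht : 0 < t) {f : EuclideanSpace ℝ (Fin n) → ℝ}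
    (hf : ∀ x, 0 ≤ f x) (x : EuclideanSpace ℝ (Fin n)) : 0 ≤ heatOp n t f x :=
  integral_nonneg fun z => mul_nonneg (heatKernel_nonneg n ht _) (hf z)

lemma heatOp_eq_convolution (n : ℕ) (t : ℝ) (f : EuclideanSpace ℝ (Fin n) → ℝ) :
    heatOp n t f = convolution f (heatKernel n t) (ContinuousLinearMap.mul ℝ ℝ) volume := by
  ext x
  simp only [heatOp_eq_integral, convolution, ContinuousLinearMap.mul_apply', mul_comm]

lemma integrable_heatOp (n : ℕ) {t : ℝ} (ht : 0 < t) {f : EuclideanSpace ℝ (Fin n) → ℝ}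
    (hf : Integrable f) : Integrable (heatOp n t f) := by
  rw [heatOp_eq_convolution]
  exact hf.integrable_convolution _ (integrable_heatKernel n ht)

lemma integral_heatOp (n : ℕ) {t : ℝ} (ht : 0 < t) {f : EuclideanSpace ℝ (Fin n) → ℝ}
    (hf : Integrable f) : ∫ x, heatOp n t f x = ∫ x, f x := by
  rw [heatOp_eq_convolution, integral_convolution _ hf (integrable_heatKernel n ht),
    integral_heatKernel n ht, ContinuousLinearMap.mul_apply', mul_one]

/-- The product of two heat kernels along `x, z, y` is controlled by kernels in `x - z` and
`x - y` at larger times. -/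
lemma heatKernel_mul_heatKernel_le (n : ℕ) {t : ℝ} (ht : 0 < t)
    (x y z : EuclideanSpace ℝ (Fin n)) :
    heatKernel n t (x - z) * heatKernel n t (z - y) ≤
      8 ^ ((n : ℝ) / 2) * (heatKernel n (2 * t) (x - z) * heatKernel n (4 * t) (x - y)) := by
  have hconst : (8 : ℝ) ^ ((n : ℝ) / 2) * ((4 * Real.pi * (2 * t)) ^ (-(n : ℝ) / 2) *
      (4 * Real.pi * (4 * t)) ^ (-(n : ℝ) / 2)) =
      (4 * Real.pi * t) ^ (-(n : ℝ) / 2) * (4 * Real.pi * t) ^ (-(n : ℝ) / 2) := by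
    rw [← Real.mul_rpow (by positivity) (by positivity),
      ← Real.mul_rpow (by positivity) (by positivity),
      show 4 * Real.pi * (2 * t) * (4 * Real.pi * (4 * t)) =
        8 * (4 * Real.pi * t * (4 * Real.pi * t)) by ring,
      Real.mul_rpow (x := 8) (by positivity) (by positivity), ← mul_assoc,
      ← Real.rpow_add (by positivity), neg_div, add_neg_cancel, Real.rpow_zero, one_mul]
  have hnorm : ‖x - y‖ ^ 2 ≤ 2 * ‖x - z‖ ^ 2 + 2 * ‖z - y‖ ^ 2 := by
    have h := norm_sub_le_norm_sub_add_norm_sub x z y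
    nlinarith [norm_nonneg (x - y), sq_nonneg (‖x - z‖ - ‖z - y‖)]
  have hexp : Real.exp (-‖x - z‖ ^ 2 / (4 * t)) * Real.exp (-‖z - y‖ ^ 2 / (4 * t)) ≤
      Real.exp (-‖x - z‖ ^ 2 / (4 * (2 * t))) * Real.exp (-‖x - y‖ ^ 2 / (4 * (4 * t))) := by
    rw [← Real.exp_add, ← Real.exp_add, Real.exp_le_exp]
    have hdiff : -‖x - z‖ ^ 2 / (4 * (2 * t)) + -‖x - y‖ ^ 2 / (4 * (4 * t)) -
        (-‖x - z‖ ^ 2 / (4 * t) + -‖z - y‖ ^ 2 / (4 * t)) =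
        (2 * ‖x - z‖ ^ 2 + 4 * ‖z - y‖ ^ 2 - ‖x - y‖ ^ 2) / (16 * t) := by
      field_simp
      ring
    rw [← sub_nonneg, hdiff]
    exact div_nonneg (by nlinarith [sq_nonneg ‖z - y‖]) (by positivity)
  calc heatKernel n t (x - z) * heatKernel n t (z - y)
      = ((4 * Real.pi * t) ^ (-(n : ℝ) / 2) * (4 * Real.pi * t) ^ (-(n : ℝ) / 2)) *
        (Real.exp (-‖x - z‖ ^ 2 / (4 * t)) * Real.exp (-‖z - y‖ ^ 2 / (4 * t))) := by
        unfold heatKernel; ring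
    _ ≤ ((4 * Real.pi * t) ^ (-(n : ℝ) / 2) * (4 * Real.pi * t) ^ (-(n : ℝ) / 2)) *
        (Real.exp (-‖x - z‖ ^ 2 / (4 * (2 * t))) * Real.exp (-‖x - y‖ ^ 2 / (4 * (4 * t)))) := by
        gcongr
    _ = _ := by rw [← hconst]; unfold heatKernel; ring

lemma heatKernel_mul_heatOp_le (n : ℕ) {t : ℝ} (ht : 0 < t)
    {g : EuclideanSpace ℝ (Fin n) → ℝ} (hg : ∀ x, 0 ≤ g x) (hgi : Integrable g)
    (x z : EuclideanSpace ℝ (Fin n)) :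
    heatKernel n t (x - z) * heatOp n t g z ≤
      8 ^ ((n : ℝ) / 2) * (heatKernel n (2 * t) (x - z) * heatOp n (4 * t) g x) := by
  simp only [heatOp_eq_integral, ← integral_const_mul]
  refine integral_mono ((integrable_heatKernel_sub_mul n ht hgi z).const_mul _)
    (((integrable_heatKernel_sub_mul n (by positivity) hgi x).const_mul _).const_mul _)
    fun y => ?_
  linarith [mul_le_mul_of_nonneg_right (heatKernel_mul_heatKernel_le n ht x y z) (hg y)]

lemma heatOp_mul_heatOp_le (n : ℕ) {t : ℝ} (ht : 0 < t)
    {f g : EuclideanSpace ℝ (Fin n) → ℝ} (hf : ∀ x, 0 ≤ f x) (hg : ∀ x, 0 ≤ g x)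
    (hfi : Integrable f) (hgi : Integrable g) (x : EuclideanSpace ℝ (Fin n)) :
    heatOp n t (fun s => f s * heatOp n t g s) x ≤
      8 ^ ((n : ℝ) / 2) * (heatOp n (2 * t) f x * heatOp n (4 * t) g x) := by
  rw [heatOp_eq_integral n t, heatOp_eq_integral n (2 * t), ← integral_mul_const,
    ← integral_const_mul]
  refine integral_mono_of_nonneg (.of_forall fun z => mul_nonneg (heatKernel_nonneg n ht _)
      (mul_nonneg (hf z) (heatOp_nonneg n ht hg z)))
    (((integrable_heatKernel_sub_mul n (by positivity) hfi x).mul_const _).const_mul _)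
    (.of_forall fun z => ?_)
  linarith [mul_le_mul_of_nonneg_left (heatKernel_mul_heatOp_le n ht hg hgi x z) (hf z)]

lemma memLp_two_sqrt {α : Type*} [MeasurableSpace α] {μ : Measure α} {f : α → ℝ}
    (hf : ∀ x, 0 ≤ f x) (hfi : Integrable f μ) : MemLp (fun x => √(f x)) 2 μ := by
  rw [memLp_two_iff_integrable_sq
    (Real.continuous_sqrt.comp_aestronglyMeasurable hfi.aestronglyMeasurable)]
  simpa only [Real.sq_sqrt (hf _)] using hfi

/-- The Cauchy-Schwarz inequality for square roots of integrable functions. -/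
lemma integral_sqrt_mul_sqrt_le {α : Type*} [MeasurableSpace α] {μ : Measure α} {f g : α → ℝ}
    (hf : ∀ x, 0 ≤ f x) (hg : ∀ x, 0 ≤ g x) (hfi : Integrable f μ) (hgi : Integrable g μ) :
    ∫ x, √(f x) * √(g x) ∂μ ≤ √(∫ x, f x ∂μ) * √(∫ x, g x ∂μ) := by
  have h := integral_mul_le_Lp_mul_Lq_of_nonneg (μ := μ) Real.HolderConjugate.two_two
    (.of_forall fun x => Real.sqrt_nonneg (f x)) (.of_forall fun x => Real.sqrt_nonneg (g x))
    (by simpa using memLp_two_sqrt hf hfi) (by simpa using memLp_two_sqrt hg hgi)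
  simpa only [Real.rpow_two, Real.sq_sqrt (hf _), Real.sq_sqrt (hg _), ← Real.sqrt_eq_rpow] using h

/-- Appendix Corollary of the paper: the classical heat semigroup on `ℝⁿ`
satisfies the `L^{1/2}` condition with constant depending only on `n`. -/
theorem heat_semigroup_Lhalf_condition (n : ℕ) (hn : 1 ≤ n) :
    ∃ c : ℝ, 0 < c ∧
      ∀ t : ℝ, 0 < t →
      ∀ f g : EuclideanSpace ℝ (Fin n) → ℝ,
        (∀ x, 0 ≤ f x) → (∀ x, 0 ≤ g x) →
        Integrable f (volume : Measure (EuclideanSpace ℝ (Fin n))) →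
        Integrable g (volume : Measure (EuclideanSpace ℝ (Fin n))) →
        ((∫ x, Real.sqrt (heatOp n t (fun s => f s * heatOp n t g s) x)) ≤
            c * Real.sqrt (∫ x, f x) * Real.sqrt (∫ x, g x)) ∧
          ((∫ x, Real.sqrt (heatOp n t (fun s => f s * heatOp n t g s) x)) ^ 2 ≤
            c ^ 2 * (∫ x, f x) * (∫ x, g x)) := by
  refine ⟨√(8 ^ ((n : ℝ) / 2)), by positivity, fun t ht f g hf hg hfi hgi => ?_⟩
  have ht2 : 0 < 2 * t := by positivity
  have ht4 : 0 < 4 * t := by positivity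
  have hF := heatOp_nonneg n ht2 hf
  have hG := heatOp_nonneg n ht4 hg
  have hFi := integrable_heatOp n ht2 hfi
  have hGi := integrable_heatOp n ht4 hgi
  have key : (∫ x, √(heatOp n t (fun s => f s * heatOp n t g s) x)) ≤
      √(8 ^ ((n : ℝ) / 2)) * √(∫ x, f x) * √(∫ x, g x) := calc
    _ ≤ ∫ x, √(8 ^ ((n : ℝ) / 2)) * (√(heatOp n (2 * t) f x) * √(heatOp n (4 * t) g x)) := by
      refine integral_mono_of_nonneg (.of_forall fun x => Real.sqrt_nonneg _)
        (((memLp_two_sqrt hF hFi).integrable_mul (memLp_two_sqrt hG hGi)).const_mul _)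
        (.of_forall fun x => ?_)
      dsimp only
      rw [← Real.sqrt_mul (hF x), ← Real.sqrt_mul (by positivity)]
      exact Real.sqrt_le_sqrt (heatOp_mul_heatOp_le n ht hf hg hfi hgi x)
    _ ≤ √(8 ^ ((n : ℝ) / 2)) * (√(∫ x, f x) * √(∫ x, g x)) := by
      rw [integral_const_mul, ← integral_heatOp n ht2 hfi, ← integral_heatOp n ht4 hgi]
      gcongr
      exact integral_sqrt_mul_sqrt_le hF hG hFi hGi
    _ = _ := (mul_assoc _ _ _).symm
  refine ⟨key, (pow_le_pow_left₀ (integral_nonneg fun x => Real.sqrt_nonneg _) key 2).trans_eq ?_⟩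
  rw [mul_pow, mul_pow, Real.sq_sqrt (integral_nonneg hf), Real.sq_sqrt (integral_nonneg hg)]
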